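/- The midway partition of a dyadic rectangle is balanced. Concretely: (i) for all positive integers H ≤ W with W ≥ 2, setting W_A = ⌈W/2⌉ and W_B = W − W_A, the vertical-cut partition of a W×H rectangle into a W_A×H rectangle and a W_B×H rectangle is balanced, i.e., writing E(a,b) = max(a,b)/min(a,b), one has max(E(W_A, H), E(W_B, H)) ≤ max(3, (2/3)·(W/H)); and (ii) for any s > 0, the partition of the s×s square into two rectangles of width s/2 and height s is balanced (each part has eccentricity 2 ≤ 3). -/

import Mathlib

/-- The eccentricity of a rectangle with side lengths `a` and `b`: the ratio of the longer side
to the shorter side. -/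
noncomputable def ecc (a b : ℝ) : ℝ := max a b / min a b

/-- A piece of length `x` and height `h` cut from a side of length `w` is balanced as soon as
`x` is at least a third of `h` and at most two thirds of `w`. -/
theorem ecc_le_max_of_le {x h w : ℝ} (hx : 0 < x) (hh : 0 < h) (hhx : h ≤ 3 * x)
    (hxw : x ≤ 2 / 3 * w) : ecc x h ≤ max 3 (2 / 3 * (w / h)) := by
  unfold ecc
  rcases le_total x h with hle | hle
  · rw [max_eq_right hle, min_eq_left hle]
    exact le_max_of_le_left ((div_le_iff₀ hx).2 hhx)
  · rw [max_eq_left hle, min_eq_right hle, ← mul_div_assoc]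
    exact le_max_of_le_right (div_le_div_of_nonneg_right hxw hh.le)

/-- The midway partition of a dyadic rectangle is balanced.
(i) For positive integers `H ≤ W` with `W ≥ 2`, cutting a `W × H` rectangle vertically into a
`⌈W/2⌉ × H` piece and a `(W − ⌈W/2⌉) × H` piece yields a balanced partition:
`max(E(W_A, H), E(W_B, H)) ≤ max(3, (2/3)·(W/H))`.
(ii) For any `s > 0`, cutting the `s × s` square into two rectangles of width `s/2` and height
`s` yields a balanced partition (each part has eccentricity `2 ≤ 3`). -/
theorem midway_partition_balanced :
    (∀ W H : ℕ, 0 < H → H ≤ W → 2 ≤ W →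
      ∀ WA WB : ℕ, WA = (W + 1) / 2 → WB = W - WA →
        max (ecc (WA : ℝ) (H : ℝ)) (ecc (WB : ℝ) (H : ℝ)) ≤
          max 3 (2 / 3 * ((W : ℝ) / (H : ℝ)))) ∧
    (∀ s : ℝ, 0 < s →
      max (ecc (s / 2) s) (ecc (s / 2) s) ≤ max 3 (2 / 3 * ecc s s)) := by
  refine ⟨fun W H hH hHW hW WA WB hA hB => ?_, fun s hs => ?_⟩
  · have piece_le (x : ℕ) (hx : 0 < x) (hHx : H ≤ 3 * x) (hxW : 3 * x ≤ 2 * W) :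
        ecc (x : ℝ) (H : ℝ) ≤ max 3 (2 / 3 * ((W : ℝ) / (H : ℝ))) := by
      have hxW' : 3 * (x : ℝ) ≤ 2 * W := by exact_mod_cast hxW
      exact ecc_le_max_of_le (by exact_mod_cast hx) (by exact_mod_cast hH)
        (by exact_mod_cast hHx) (by linarith)
    exact max_le (piece_le WA (by omega) (by omega) (by omega))
      (piece_le WB (by omega) (by omega) (by omega))
  · have hss : ecc s s = s / s := by simp [ecc]
    rw [max_self, hss]
    exact ecc_le_max_of_le (by linarith) hs (by linarith) (by linarith)
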